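/- Let L_1,…,L_n and R_1,…,R_n be strictly positive operators on H. Then ∑_{i=1}^n R_i ≤ ∑_{i=1}^n L_i + ∑_{i=1}^n R_i^{1/2} log(R_i^{1/2} L_i^{−1} R_i^{1/2}) R_i^{1/2} in the Loewner order; that is, the operator Kullback–Leibler functional Θ(L̃,R̃) = ∑_{i=1}^n R_i^{1/2} log(R_i^{1/2} L_i^{−1} R_i^{1/2}) R_i^{1/2} satisfies ∑_{i=1}^n (R_i − L_i) ≤ Θ(L̃,R̃). In particular, for strictly positive A, B, C, D, A + B ≤ C + D + A^{1/2} log(A^{1/2} C^{−1} A^{1/2}) A^{1/2} + B^{1/2} log(B^{1/2} D^{−1} B^{1/2}) B^{1/2}. -/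

import Mathlib

open scoped InnerProductSpace

noncomputable section

variable {H : Type} [NormedAddCommGroup H] [InnerProductSpace ℂ H] [CompleteSpace H]

/-- `R^{1/2}` via the continuous functional calculus. -/
def opSqrt (R : H →L[ℂ] H) : H →L[ℂ] H := cfc Real.sqrt R

/-- The operator inequality `1 - X⁻¹ ≤ log X` for strictly positive `X`. -/
theorem one_sub_ringInverse_le_cfc_log {X : H →L[ℂ] H} (hX : 0 ≤ X) (hXu : IsUnit X) :
    1 - Ring.inverse X ≤ cfc Real.log X := by
  have hsa : IsSelfAdjoint X := IsSelfAdjoint.of_nonneg hX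
  have hpos : ∀ x ∈ spectrum ℝ X, 0 < x := fun x hx =>
    lt_of_le_of_ne (spectrum_nonneg_of_nonneg hX hx)
      fun h => spectrum.zero_notMem ℝ hXu (h ▸ hx)
  have hinv : ContinuousOn (fun x : ℝ => x⁻¹) (spectrum ℝ X) :=
    continuousOn_id.inv₀ fun x hx => (hpos x hx).ne'
  have hlog : ContinuousOn Real.log (spectrum ℝ X) :=
    continuousOn_id.log fun x hx => (hpos x hx).ne'
  have hmul : cfc (fun x : ℝ => x⁻¹) X * X = 1 := by
    nth_rewrite 2 [← cfc_id ℝ X]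
    rw [← cfc_mul _ _ X hinv continuousOn_id, ← cfc_one ℝ X]
    exact cfc_congr fun x hx => inv_mul_cancel₀ (hpos x hx).ne'
  have hinvX : cfc (fun x : ℝ => x⁻¹) X = Ring.inverse X := by
    rw [← mul_one (cfc _ X), ← Ring.mul_inverse_cancel X hXu, ← mul_assoc, hmul, one_mul]
  rw [← hinvX, ← cfc_const_one ℝ X, ← cfc_sub _ _ X continuousOn_const hinv]
  exact cfc_mono (fun x hx => Real.one_sub_inv_le_log_of_pos (hpos x hx))
    (continuousOn_const.sub hinv) hlog

theorem opSqrt_isSelfAdjoint (R : H →L[ℂ] H) : IsSelfAdjoint (opSqrt R) :=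
  cfc_predicate _ _

theorem opSqrt_mul_self {R : H →L[ℂ] H} (hR : 0 ≤ R) : opSqrt R * opSqrt R = R := by
  have hsa : IsSelfAdjoint R := IsSelfAdjoint.of_nonneg hR
  have hc : ContinuousOn Real.sqrt (spectrum ℝ R) := Real.continuous_sqrt.continuousOn
  rw [opSqrt, ← cfc_mul _ _ R hc hc]
  conv_rhs => rw [← cfc_id ℝ R]
  exact cfc_congr fun x hx => Real.mul_self_sqrt (spectrum_nonneg_of_nonneg hR hx)

theorem isUnit_opSqrt {R : H →L[ℂ] H} (hR : 0 ≤ R) (hRu : IsUnit R) : IsUnit (opSqrt R) := by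
  rw [← opSqrt_mul_self hR] at hRu
  exact ((Commute.refl (opSqrt R)).isUnit_mul_iff.mp hRu).1

/-- The Klein-type inequality `R - L ≤ R^{1/2} log(R^{1/2} L⁻¹ R^{1/2}) R^{1/2}`. -/
theorem sub_le_opSqrt_mul_cfc_log_mul_opSqrt {L R : H →L[ℂ] H}
    (hL : 0 ≤ L) (hLu : IsUnit L) (hR : 0 ≤ R) (hRu : IsUnit R) :
    R - L ≤ opSqrt R * cfc Real.log (opSqrt R * Ring.inverse L * opSqrt R) * opSqrt R := by
  have hS := opSqrt_isSelfAdjoint R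
  have hSu := isUnit_opSqrt hR hRu
  have hSS := opSqrt_mul_self hR
  set S := opSqrt R
  have hLi : 0 ≤ Ring.inverse L := by
    have hLsa : IsSelfAdjoint (Ring.inverse L) := by
      rw [IsSelfAdjoint, ← Ring.inverse_star, (IsSelfAdjoint.of_nonneg hL).star_eq]
    have h := hLsa.conjugate_nonneg hL
    rwa [Ring.inverse_mul_cancel L hLu, one_mul] at h
  have hX : 0 ≤ S * Ring.inverse L * S := hS.conjugate_nonneg hLi
  have hXu : IsUnit (S * Ring.inverse L * S) := (hSu.mul hLu.ringInverse).mul hSu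
  have h := hS.conjugate_le_conjugate (one_sub_ringInverse_le_cfc_log hX hXu)
  have hSXS : S * Ring.inverse (S * Ring.inverse L * S) * S = L := by
    lift S to (H →L[ℂ] H)ˣ using hSu with s
    lift L to (H →L[ℂ] H)ˣ using hLu with l
    rw [Ring.inverse_unit, ← Units.val_mul, ← Units.val_mul, Ring.inverse_unit,
      ← Units.val_mul, ← Units.val_mul]
    congr 1
    group
  rwa [mul_sub, sub_mul, mul_one, hSS, hSXS] at h

/-- The operator Kullback–Leibler functional
`Θ(L̃, R̃) = ∑ i, R i ^ (1/2) * log(R i ^ (1/2) * (L i)⁻¹ * R i ^ (1/2)) * R i ^ (1/2)`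
satisfies `∑ i, (R i - L i) ≤ Θ(L̃, R̃)`, i.e.
`∑ i, R i ≤ ∑ i, L i + Θ(L̃, R̃)`. -/
theorem stmt_19 (n : ℕ) (L R : Fin n → H →L[ℂ] H)
    (hL : ∀ i, 0 ≤ L i) (hLu : ∀ i, IsUnit (L i))
    (hR : ∀ i, 0 ≤ R i) (hRu : ∀ i, IsUnit (R i)) :
    (∑ i, R i) ≤ (∑ i, L i) +
      ∑ i, opSqrt (R i) *
        cfc Real.log (opSqrt (R i) * Ring.inverse (L i) * opSqrt (R i)) * opSqrt (R i) := by
  rw [← Finset.sum_add_distrib]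
  exact Finset.sum_le_sum fun i _ => sub_le_iff_le_add'.mp
    (sub_le_opSqrt_mul_cfc_log_mul_opSqrt (hL i) (hLu i) (hR i) (hRu i))
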